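/- arXiv:1607.05927 — 5 statements merged into one kernel-verified Lean document; each statement's English description precedes it below -/
import Mathlib

section
/- Let Q be an n×n positive definite real matrix, R a p×p positive definite real matrix, T a d×d positive semidefinite real matrix, and let Γ (n×s), Ψ (p×s), M (n×p), and B' (d×s) be real matrices. If Γμ = 0 and Ψμ = 0 together imply μ = 0, then the s×s matrix ΨᵀRΨ + (Γ + MΨ)ᵀQ(Γ + MΨ) + B'ᵀTB' is positive definite. -/
open Matrix

theorem star_dotProduct_transpose_mul_mul_mulVec {m k : Type*} [Fintype m] [Fintype k]
    (A : Matrix m m ℝ) (C : Matrix m k ℝ) (x : k → ℝ) :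
    star x ⬝ᵥ ((Cᵀ * A * C) *ᵥ x) = star (C *ᵥ x) ⬝ᵥ (A *ᵥ (C *ᵥ x)) := by
  simp only [star_trivial, ← mulVec_mulVec, dotProduct_mulVec, vecMul_transpose]

/-- Positive definiteness of ΨᵀRΨ + (Γ + MΨ)ᵀQ(Γ + MΨ) + B'ᵀTB' under injectivity
of the stacked matrix [Γ; Ψ]. -/
theorem posDef_of_stacked_injective
    {n p d s : ℕ}
    (Q : Matrix (Fin n) (Fin n) ℝ) (hQ : Q.PosDef)
    (R : Matrix (Fin p) (Fin p) ℝ) (hR : R.PosDef)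
    (T : Matrix (Fin d) (Fin d) ℝ) (hT : T.PosSemidef)
    (Γ : Matrix (Fin n) (Fin s) ℝ)
    (Ψ : Matrix (Fin p) (Fin s) ℝ)
    (M : Matrix (Fin n) (Fin p) ℝ)
    (B' : Matrix (Fin d) (Fin s) ℝ)
    (hinj : ∀ μ : Fin s → ℝ, Γ *ᵥ μ = 0 → Ψ *ᵥ μ = 0 → μ = 0) :
    (Ψᵀ * R * Ψ + (Γ + M * Ψ)ᵀ * Q * (Γ + M * Ψ) + B'ᵀ * T * B').PosDef := by
  have hΨR := hR.posSemidef.conjTranspose_mul_mul_same Ψ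
  have hGQ := hQ.posSemidef.conjTranspose_mul_mul_same (Γ + M * Ψ)
  have hBT := hT.conjTranspose_mul_mul_same B'
  simp only [conjTranspose_eq_transpose_of_trivial] at hΨR hGQ hBT
  refine PosDef.add_posSemidef
    (PosDef.of_dotProduct_mulVec_pos (hΨR.isHermitian.add hGQ.isHermitian) fun x hx => ?_) hBT
  rw [add_mulVec, dotProduct_add]
  by_cases hΨ : Ψ *ᵥ x = 0
  · have hΓ : (Γ + M * Ψ) *ᵥ x ≠ 0 := by
      rw [add_mulVec, ← mulVec_mulVec, hΨ, mulVec_zero, add_zero]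
      exact fun h => hx (hinj x h hΨ)
    refine add_pos_of_nonneg_of_pos (hΨR.dotProduct_mulVec_nonneg x) ?_
    rw [star_dotProduct_transpose_mul_mul_mulVec]
    exact hQ.dotProduct_mulVec_pos hΓ
  · refine add_pos_of_pos_of_nonneg ?_ (hGQ.dotProduct_mulVec_nonneg x)
    rw [star_dotProduct_transpose_mul_mul_mulVec]
    exact hR.dotProduct_mulVec_pos hΨ
end

section
/- Let F be a q×q symmetric real matrix, Q a d×d symmetric real matrix, and let A (d×d), B (d×s), C (q×d), D (q×s) be real matrices. Suppose M := DᵀFD + BᵀQB is invertible. Set G := DᵀFC + BᵀQA, X := C − DM⁻¹G, and Y := A − BM⁻¹G. Then CᵀFC + AᵀQA − GᵀM⁻¹G = XᵀFX + YᵀQY. Consequently, if F and Q are positive semidefinite, then CᵀFC + AᵀQA − GᵀM⁻¹G is positive semidefinite. -/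
open Matrix

/-- Expansion of the quadratic form of a symmetric matrix at a difference `C - D * K`. -/
theorem Matrix.IsSymm.transpose_mul_mul_sub {R l m n : Type*} [CommRing R]
    [Fintype l] [Fintype m] {F : Matrix l l R} (hF : F.IsSymm)
    (C : Matrix l n R) (D : Matrix l m R) (K : Matrix m n R) :
    (C - D * K)ᵀ * F * (C - D * K) =
      Cᵀ * F * C - (Dᵀ * F * C)ᵀ * K - Kᵀ * (Dᵀ * F * C) + Kᵀ * (Dᵀ * F * D) * K := by
  simp only [transpose_sub, transpose_mul, transpose_transpose, hF.eq, Matrix.sub_mul,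
    Matrix.mul_sub, Matrix.mul_assoc]
  abel

/-- Completing the square for a sum of two quadratic forms, where `K` solves the normal
equation of the minimization problem. -/
theorem Matrix.IsSymm.add_sub_eq_transpose_mul_mul_add {R l m n p : Type*} [CommRing R]
    [Fintype l] [Fintype m] [Fintype p]
    {F : Matrix l l R} {Q : Matrix p p R} (hF : F.IsSymm) (hQ : Q.IsSymm)
    {A : Matrix p n R} {B : Matrix p m R} {C : Matrix l n R} {D : Matrix l m R}
    {K : Matrix m n R}
    (hK : (Dᵀ * F * D + Bᵀ * Q * B) * K = Dᵀ * F * C + Bᵀ * Q * A) :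
    Cᵀ * F * C + Aᵀ * Q * A - (Dᵀ * F * C + Bᵀ * Q * A)ᵀ * K =
      (C - D * K)ᵀ * F * (C - D * K) + (A - B * K)ᵀ * Q * (A - B * K) := by
  have h := congrArg (Kᵀ * ·) hK
  simp only [Matrix.add_mul, Matrix.mul_add, ← Matrix.mul_assoc Kᵀ _ K] at h
  rw [hF.transpose_mul_mul_sub, hQ.transpose_mul_mul_sub, transpose_add, Matrix.add_mul,
    ← sub_eq_zero]
  rw [← sub_eq_zero] at h
  rw [← neg_eq_zero, ← h]
  abel

/-- Riccati-type recursion factorization (Lemma 2 of the paper):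
CᵀFC + AᵀQA − GᵀM⁻¹G = XᵀFX + YᵀQY, where M = DᵀFD + BᵀQB is invertible,
G = DᵀFC + BᵀQA, X = C − DM⁻¹G, Y = A − BM⁻¹G; hence the left-hand side is
positive semidefinite whenever F and Q are. -/
theorem riccati_factorization
    {q d s : ℕ}
    (F : Matrix (Fin q) (Fin q) ℝ) (hF : F.IsSymm)
    (Q : Matrix (Fin d) (Fin d) ℝ) (hQ : Q.IsSymm)
    (A : Matrix (Fin d) (Fin d) ℝ) (B : Matrix (Fin d) (Fin s) ℝ)
    (C : Matrix (Fin q) (Fin d) ℝ) (D : Matrix (Fin q) (Fin s) ℝ)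
    (hM : IsUnit (Dᵀ * F * D + Bᵀ * Q * B).det) :
    (Cᵀ * F * C + Aᵀ * Q * A -
        (Dᵀ * F * C + Bᵀ * Q * A)ᵀ * (Dᵀ * F * D + Bᵀ * Q * B)⁻¹ *
          (Dᵀ * F * C + Bᵀ * Q * A)
      = (C - D * ((Dᵀ * F * D + Bᵀ * Q * B)⁻¹ * (Dᵀ * F * C + Bᵀ * Q * A)))ᵀ * F *
          (C - D * ((Dᵀ * F * D + Bᵀ * Q * B)⁻¹ * (Dᵀ * F * C + Bᵀ * Q * A)))
        + (A - B * ((Dᵀ * F * D + Bᵀ * Q * B)⁻¹ * (Dᵀ * F * C + Bᵀ * Q * A)))ᵀ * Q *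
          (A - B * ((Dᵀ * F * D + Bᵀ * Q * B)⁻¹ * (Dᵀ * F * C + Bᵀ * Q * A))))
    ∧ (F.PosSemidef → Q.PosSemidef →
        (Cᵀ * F * C + Aᵀ * Q * A -
          (Dᵀ * F * C + Bᵀ * Q * A)ᵀ * (Dᵀ * F * D + Bᵀ * Q * B)⁻¹ *
            (Dᵀ * F * C + Bᵀ * Q * A)).PosSemidef) := by
  have key := hF.add_sub_eq_transpose_mul_mul_add hQ
    (Matrix.mul_nonsing_inv_cancel_left _ (Dᵀ * F * C + Bᵀ * Q * A) hM)
  rw [← Matrix.mul_assoc _ (_⁻¹)] at key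
  refine ⟨key, fun hFp hQp => ?_⟩
  rw [key]
  simpa only [conjTranspose_eq_transpose_of_trivial] using
    (hFp.conjTranspose_mul_mul_same _).add (hQp.conjTranspose_mul_mul_same _)
end

section
/- Let Q be a d×d symmetric real matrix and F a q×q symmetric real matrix, and let A (d×d), B (d×s), C (q×d), D (q×s), N (q×p) be real matrices. Suppose the s×s matrix M := DᵀFD + BᵀQB is invertible, and set G := DᵀFC + BᵀQA. Fix ξ ∈ ℝᵈ and ν ∈ ℝᵖ, define J(e) := (Aξ + Be)ᵀQ(Aξ + Be) + (Cξ + De + Nν)ᵀF(Cξ + De + Nν) and e* := −M⁻¹(Gξ + DᵀFNν). Then J(e*) = ξᵀ𝒬ξ + 2ξᵀℛν + νᵀ𝒮ν, where 𝒬 = CᵀFC + AᵀQA − GᵀM⁻¹G, ℛ = CᵀFN − GᵀM⁻¹DᵀFN, and 𝒮 = NᵀFN − NᵀFD M⁻¹ DᵀFN. -/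
open Matrix

namespace Matrix

theorem dotProduct_transpose_mul_mul_mulVec {R l m n o : Type*} [CommSemiring R]
    [Fintype l] [Fintype m] [Fintype n] [Fintype o]
    (X : Matrix m l R) (K : Matrix m n R) (Y : Matrix n o R) (x : l → R) (y : o → R) :
    x ⬝ᵥ ((Xᵀ * K * Y) *ᵥ y) = (X *ᵥ x) ⬝ᵥ (K *ᵥ (Y *ᵥ y)) := by
  rw [← mulVec_mulVec, ← mulVec_mulVec, dotProduct_mulVec, vecMul_transpose]

theorem IsSymm.dotProduct_mulVec_comm {R n : Type*} [CommSemiring R] [Fintype n]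
    {K : Matrix n n R} (hK : K.IsSymm) (x y : n → R) :
    x ⬝ᵥ (K *ᵥ y) = y ⬝ᵥ (K *ᵥ x) := by
  rw [dotProduct_mulVec, ← mulVec_transpose, hK.eq, dotProduct_comm]

theorem IsSymm.transpose_mul_mul {R m n : Type*} [CommSemiring R] [Fintype m]
    {K : Matrix m m R} (hK : K.IsSymm) (X : Matrix m n R) : (Xᵀ * K * X).IsSymm := by
  simp [IsSymm, transpose_mul, hK.eq, Matrix.mul_assoc]

/-- The value of the quadratic function `e ↦ eᵀ M e + 2 eᵀ w` at its stationary point. -/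
theorem quadratic_value_neg_inv_mulVec {R n : Type*} [CommRing R] [Fintype n] [DecidableEq n]
    {M : Matrix n n R} (hM : IsUnit M.det) (w : n → R) :
    (-(M⁻¹ *ᵥ w)) ⬝ᵥ (M *ᵥ (-(M⁻¹ *ᵥ w))) + 2 * ((-(M⁻¹ *ᵥ w)) ⬝ᵥ w) =
      -(w ⬝ᵥ (M⁻¹ *ᵥ w)) := by
  rw [mulVec_neg, mulVec_mulVec, mul_nonsing_inv _ hM, one_mulVec, dotProduct_neg,
    neg_dotProduct, dotProduct_comm]
  ring

end Matrix

/-- Value (return-function) computation in the dynamic-programming proof of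
Theorem 1: the optimal value J(e*) is quadratic in (ξ, ν) with matrices
𝒬, ℛ, 𝒮 given by the backward recursions. -/
theorem dp_step_value
    {d q s p : ℕ}
    (Q : Matrix (Fin d) (Fin d) ℝ) (hQ : Q.IsSymm)
    (F : Matrix (Fin q) (Fin q) ℝ) (hF : F.IsSymm)
    (A : Matrix (Fin d) (Fin d) ℝ) (B : Matrix (Fin d) (Fin s) ℝ)
    (C : Matrix (Fin q) (Fin d) ℝ) (D : Matrix (Fin q) (Fin s) ℝ)
    (N : Matrix (Fin q) (Fin p) ℝ)
    (hM : IsUnit (Dᵀ * F * D + Bᵀ * Q * B).det)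
    (ξ : Fin d → ℝ) (ν : Fin p → ℝ)
    (J : (Fin s → ℝ) → ℝ)
    (hJ : ∀ e : Fin s → ℝ,
      J e = (A *ᵥ ξ + B *ᵥ e) ⬝ᵥ (Q *ᵥ (A *ᵥ ξ + B *ᵥ e)) +
            (C *ᵥ ξ + D *ᵥ e + N *ᵥ ν) ⬝ᵥ (F *ᵥ (C *ᵥ ξ + D *ᵥ e + N *ᵥ ν)))
    (estar : Fin s → ℝ)
    (hestar : estar = -((Dᵀ * F * D + Bᵀ * Q * B)⁻¹ *ᵥ
        ((Dᵀ * F * C + Bᵀ * Q * A) *ᵥ ξ + (Dᵀ * F * N) *ᵥ ν))) :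
    J estar =
      ξ ⬝ᵥ ((Cᵀ * F * C + Aᵀ * Q * A -
          (Dᵀ * F * C + Bᵀ * Q * A)ᵀ * (Dᵀ * F * D + Bᵀ * Q * B)⁻¹ *
            (Dᵀ * F * C + Bᵀ * Q * A)) *ᵥ ξ)
      + 2 * (ξ ⬝ᵥ ((Cᵀ * F * N -
          (Dᵀ * F * C + Bᵀ * Q * A)ᵀ * (Dᵀ * F * D + Bᵀ * Q * B)⁻¹ *
            (Dᵀ * F * N)) *ᵥ ν))
      + ν ⬝ᵥ ((Nᵀ * F * N -
          Nᵀ * F * D * (Dᵀ * F * D + Bᵀ * Q * B)⁻¹ * (Dᵀ * F * N)) *ᵥ ν) := by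
  have hMsymm : (Dᵀ * F * D + Bᵀ * Q * B).IsSymm :=
    (hF.transpose_mul_mul D).add (hQ.transpose_mul_mul B)
  have hPsymm : (Dᵀ * F * D + Bᵀ * Q * B)⁻¹.IsSymm := hMsymm.inv
  have hH : Nᵀ * F * D = (Dᵀ * F * N)ᵀ := by
    simp [transpose_mul, hF.eq, Matrix.mul_assoc]
  have hval := quadratic_value_neg_inv_mulVec hM
    ((Dᵀ * F * C + Bᵀ * Q * A) *ᵥ ξ + (Dᵀ * F * N) *ᵥ ν)
  rw [← hestar] at hval
  have hMe : estar ⬝ᵥ ((Dᵀ * F * D + Bᵀ * Q * B) *ᵥ estar) =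
      (D *ᵥ estar) ⬝ᵥ (F *ᵥ (D *ᵥ estar)) + (B *ᵥ estar) ⬝ᵥ (Q *ᵥ (B *ᵥ estar)) := by
    simp only [add_mulVec, dotProduct_add, dotProduct_transpose_mul_mul_mulVec]
  have hew : estar ⬝ᵥ ((Dᵀ * F * C + Bᵀ * Q * A) *ᵥ ξ + (Dᵀ * F * N) *ᵥ ν) =
      (D *ᵥ estar) ⬝ᵥ (F *ᵥ (C *ᵥ ξ)) + (B *ᵥ estar) ⬝ᵥ (Q *ᵥ (A *ᵥ ξ)) +
        (D *ᵥ estar) ⬝ᵥ (F *ᵥ (N *ᵥ ν)) := by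
    simp only [add_mulVec, dotProduct_add, dotProduct_transpose_mul_mul_mulVec]
  rw [hMe, hew] at hval
  rw [hJ, hH]
  clear hestar hMe hew hH hMsymm hM hJ
  generalize (Dᵀ * F * D + Bᵀ * Q * B)⁻¹ = P at *
  generalize Dᵀ * F * C + Bᵀ * Q * A = G at *
  generalize Dᵀ * F * N = H at *
  simp only [sub_mulVec, add_mulVec, mulVec_add, dotProduct_sub, dotProduct_add, add_dotProduct,
    dotProduct_transpose_mul_mul_mulVec] at hval ⊢
  linear_combination hval + hQ.dotProduct_mulVec_comm (A *ᵥ ξ) (B *ᵥ estar)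
    + hF.dotProduct_mulVec_comm (C *ᵥ ξ) (D *ᵥ estar)
    + hF.dotProduct_mulVec_comm (N *ᵥ ν) (C *ᵥ ξ)
    + hF.dotProduct_mulVec_comm (N *ᵥ ν) (D *ᵥ estar)
    - hPsymm.dotProduct_mulVec_comm (H *ᵥ ν) (G *ᵥ ξ)
end

section
/- Let F be a q×q positive definite real matrix, C a q×d real matrix, D a q×s real matrix, and N a q×p real matrix, and let G be a Moore–Penrose pseudoinverse of DᵀFD. Fix ξ ∈ ℝᵈ and ν ∈ ℝᵖ, define g(e) := (Cξ + De + Nν)ᵀF(Cξ + De + Nν) and e* := −G DᵀF(Cξ + Nν). Then g(e*) = ξᵀQ_Nξ + 2ξᵀR_Nν + νᵀS_Nν, where Q_N = CᵀFC − CᵀFD G DᵀFC, R_N = CᵀFN − CᵀFD G DᵀFN, and S_N = NᵀFN − NᵀFD G DᵀFN. -/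
open Matrix

/-- A Moore–Penrose pseudoinverse of a symmetric matrix is symmetric. -/
theorem transpose_eq_self_of_isPseudoinverse {n : Type*} [Fintype n] {S G : Matrix n n ℝ}
    (hS : Sᵀ = S) (h1 : S * G * S = S) (h2 : G * S * G = G)
    (h3 : (S * G)ᵀ = S * G) (h4 : (G * S)ᵀ = G * S) : Gᵀ = G := by
  have h1t : S * Gᵀ * S = S := by
    simpa [Matrix.transpose_mul, hS, Matrix.mul_assoc] using congrArg Matrix.transpose h1
  have h2t : Gᵀ * S * Gᵀ = Gᵀ := by
    simpa [Matrix.transpose_mul, hS, Matrix.mul_assoc] using congrArg Matrix.transpose h2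
  rw [Matrix.transpose_mul, hS] at h3 h4
  have h5 : S * G = S * Gᵀ := by
    calc S * G = Gᵀ * (S * G * S) := by rw [h1, h3]
      _ = (Gᵀ * S) * (G * S) := by simp only [Matrix.mul_assoc]
      _ = S * G * (S * Gᵀ) := by rw [h3, h4]
      _ = (S * G * S) * Gᵀ := by simp only [Matrix.mul_assoc]
      _ = S * Gᵀ := by rw [h1]
  calc Gᵀ = Gᵀ * S * Gᵀ := h2t.symm
    _ = S * G * Gᵀ := by rw [h3]
    _ = S * Gᵀ * Gᵀ := by rw [h5]
    _ = G * S * Gᵀ := by rw [h4]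
    _ = G * (S * Gᵀ) := Matrix.mul_assoc _ _ _
    _ = G * S * G := by rw [← h5, Matrix.mul_assoc]
    _ = G := h2

/-- Expansion of a symmetric quadratic form at a sum of two vectors. -/
theorem dotProduct_mulVec_add_self {n : Type*} [Fintype n] {P : Matrix n n ℝ}
    (hP : Pᵀ = P) (a b : n → ℝ) :
    (a + b) ⬝ᵥ (P *ᵥ (a + b)) = a ⬝ᵥ (P *ᵥ a) + 2 * (a ⬝ᵥ (P *ᵥ b)) + b ⬝ᵥ (P *ᵥ b) := by
  have h : b ⬝ᵥ (P *ᵥ a) = a ⬝ᵥ (P *ᵥ b) := by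
    rw [dotProduct_comm, Matrix.dotProduct_mulVec, ← Matrix.mulVec_transpose, hP]
  rw [Matrix.mulVec_add, add_dotProduct, dotProduct_add, dotProduct_add, h]
  ring

theorem mulVec_dotProduct_mulVec_mulVec {m n k : Type*} [Fintype m] [Fintype n] [Fintype k]
    (A : Matrix m n ℝ) (P : Matrix m m ℝ) (B : Matrix m k ℝ) (x : n → ℝ) (y : k → ℝ) :
    (A *ᵥ x) ⬝ᵥ (P *ᵥ (B *ᵥ y)) = x ⬝ᵥ ((Aᵀ * P * B) *ᵥ y) := by
  rw [← Matrix.vecMul_transpose, ← Matrix.dotProduct_mulVec, Matrix.mulVec_mulVec,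
    Matrix.mulVec_mulVec, Matrix.mul_assoc]

/-- Terminal value computation in the dynamic-programming proof of Theorem 1:
g(e*) = ξᵀQ_Nξ + 2ξᵀR_Nν + νᵀS_Nν with terminal matrices Q_N, R_N, S_N. -/
theorem terminal_value
    {q d s p : ℕ}
    (F : Matrix (Fin q) (Fin q) ℝ) (hF : F.PosDef)
    (C : Matrix (Fin q) (Fin d) ℝ) (D : Matrix (Fin q) (Fin s) ℝ)
    (N : Matrix (Fin q) (Fin p) ℝ)
    (G : Matrix (Fin s) (Fin s) ℝ)
    (hG1 : (Dᵀ * F * D) * G * (Dᵀ * F * D) = Dᵀ * F * D)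
    (hG2 : G * (Dᵀ * F * D) * G = G)
    (hG3 : ((Dᵀ * F * D) * G)ᵀ = (Dᵀ * F * D) * G)
    (hG4 : (G * (Dᵀ * F * D))ᵀ = G * (Dᵀ * F * D))
    (ξ : Fin d → ℝ) (ν : Fin p → ℝ)
    (g : (Fin s → ℝ) → ℝ)
    (hg : ∀ e : Fin s → ℝ,
      g e = (C *ᵥ ξ + D *ᵥ e + N *ᵥ ν) ⬝ᵥ (F *ᵥ (C *ᵥ ξ + D *ᵥ e + N *ᵥ ν)))
    (estar : Fin s → ℝ)
    (hestar : estar = -(G *ᵥ ((Dᵀ * F) *ᵥ (C *ᵥ ξ + N *ᵥ ν)))) :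
    g estar =
      ξ ⬝ᵥ ((Cᵀ * F * C - Cᵀ * F * D * G * (Dᵀ * F * C)) *ᵥ ξ)
      + 2 * (ξ ⬝ᵥ ((Cᵀ * F * N - Cᵀ * F * D * G * (Dᵀ * F * N)) *ᵥ ν))
      + ν ⬝ᵥ ((Nᵀ * F * N - Nᵀ * F * D * G * (Dᵀ * F * N)) *ᵥ ν) := by
  have hFt : Fᵀ = F := by simpa using hF.isHermitian.eq
  have hGt : Gᵀ = G := transpose_eq_self_of_isPseudoinverse
    (by simp [Matrix.transpose_mul, hFt, Matrix.mul_assoc]) hG1 hG2 hG3 hG4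
  set P : Matrix (Fin q) (Fin q) ℝ := F - F * D * G * (Dᵀ * F) with hP
  have hPt : Pᵀ = P := by
    simp [hP, Matrix.transpose_mul, hFt, hGt, Matrix.mul_assoc]
  have hvec : C *ᵥ ξ + D *ᵥ estar + N *ᵥ ν
      = (1 - D * G * (Dᵀ * F)) *ᵥ (C *ᵥ ξ + N *ᵥ ν) := by
    rw [hestar, Matrix.sub_mulVec, Matrix.one_mulVec, Matrix.mulVec_neg, Matrix.mulVec_mulVec,
      Matrix.mulVec_mulVec, Matrix.mul_assoc D G]
    abel
  have hred : (1 - D * G * (Dᵀ * F))ᵀ * F * (1 - D * G * (Dᵀ * F)) = P := by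
    have h : F * D * (G * (Dᵀ * F * D) * G) * (Dᵀ * F) = F * D * G * (Dᵀ * F) := by rw [hG2]
    simp only [Matrix.mul_assoc] at h
    simp only [hP, Matrix.transpose_sub, Matrix.transpose_one, Matrix.transpose_mul,
      Matrix.transpose_transpose, hFt, hGt, Matrix.sub_mul, Matrix.mul_sub, Matrix.one_mul,
      Matrix.mul_one, Matrix.mul_assoc, h]
    abel
  have hfold {m n : ℕ} (A : Matrix (Fin q) (Fin m) ℝ) (B : Matrix (Fin q) (Fin n) ℝ) :
      Aᵀ * F * B - Aᵀ * F * D * G * (Dᵀ * F * B) = Aᵀ * P * B := by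
    simp only [hP, Matrix.mul_sub, Matrix.sub_mul, Matrix.mul_assoc]
  rw [hg, hvec, mulVec_dotProduct_mulVec_mulVec, hred, dotProduct_mulVec_add_self hPt]
  simp only [hfold, mulVec_dotProduct_mulVec_mulVec]
end

section
/- Let A (n×n), B (n×m), C (p×n), Γ (n×s), Ψ (p×s), K (n×p), and L (m×n) be real matrices, let w : ℕ → ℝⁿ, v : ℕ → ℝᵖ, e : ℕ → ℝˢ be arbitrary sequences, and let x₀, z₀ ∈ ℝⁿ. For the attack sequence e, define sequences x^e, z^e, x̂^e : ℕ → ℝⁿ and y^e, ν^e : ℕ → ℝᵖ by x^e(0) = x₀, z^e(0) = z₀, and for every t: y^e(t) = C x^e(t) + Ψ e(t) + v(t); ν^e(t) = y^e(t) − C z^e(t); x̂^e(t) = z^e(t) + K ν^e(t); x^e(t+1) = A x^e(t) + B L x̂^e(t) + Γ e(t) + w(t); z^e(t+1) = (A + BL) x̂^e(t). Let x⁰, z⁰, x̂⁰, y⁰, ν⁰ be the sequences defined by the same recursions with the identically zero attack and the same w, v, x₀, z₀. Define ω, π, ρ : ℕ → ℝⁿ by ω(0) = π(0) = ρ(0)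 = 0 and, for every t: ω(t+1) = ((I − KC)A + BL)ω(t) + KCπ(t) + KCρ(t) + KΨe(t); π(t+1) = Aπ(t) + ABLω(t); ρ(t+1) = Aρ(t) + Γe(t). Then for every t ∈ ℕ: x̂^e(t) − x̂⁰(t) = ω(t+1) and ν^e(t) − ν⁰(t) = −CAω(t) + Cπ(t) + Cρ(t) + Ψe(t). -/
open Matrix

/-- Section III of the paper: the bias ω_{t+1} in the system's state estimate
and the innovation bias ε_t = ν_t^e − ν_t⁰ are generated by the linear
state-space system with state θ_t = (ω_t, π_t, ρ_t). -/
theorem attack_effect_bias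
    {n m p s : ℕ}
    (A : Matrix (Fin n) (Fin n) ℝ)
    (B : Matrix (Fin n) (Fin m) ℝ)
    (C : Matrix (Fin p) (Fin n) ℝ)
    (Γ : Matrix (Fin n) (Fin s) ℝ)
    (Ψ : Matrix (Fin p) (Fin s) ℝ)
    (K : Matrix (Fin n) (Fin p) ℝ)
    (L : Matrix (Fin m) (Fin n) ℝ)
    (w : ℕ → Fin n → ℝ) (v : ℕ → Fin p → ℝ) (e : ℕ → Fin s → ℝ)
    (x₀ z₀ : Fin n → ℝ)
    -- attacked trajectory
    (xe ze xhe : ℕ → Fin n → ℝ) (ye νe : ℕ → Fin p → ℝ)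
    (hxe0 : xe 0 = x₀) (hze0 : ze 0 = z₀)
    (hye : ∀ t, ye t = C *ᵥ xe t + Ψ *ᵥ e t + v t)
    (hνe : ∀ t, νe t = ye t - C *ᵥ ze t)
    (hxhe : ∀ t, xhe t = ze t + K *ᵥ νe t)
    (hxe : ∀ t, xe (t + 1) = A *ᵥ xe t + (B * L) *ᵥ xhe t + Γ *ᵥ e t + w t)
    (hze : ∀ t, ze (t + 1) = (A + B * L) *ᵥ xhe t)
    -- no-attack trajectory, with the same noise realizations
    (x0 z0 xh0 : ℕ → Fin n → ℝ) (y0 ν0 : ℕ → Fin p → ℝ)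
    (hx00 : x0 0 = x₀) (hz00 : z0 0 = z₀)
    (hy0 : ∀ t, y0 t = C *ᵥ x0 t + v t)
    (hν0 : ∀ t, ν0 t = y0 t - C *ᵥ z0 t)
    (hxh0 : ∀ t, xh0 t = z0 t + K *ᵥ ν0 t)
    (hx0 : ∀ t, x0 (t + 1) = A *ᵥ x0 t + (B * L) *ᵥ xh0 t + w t)
    (hz0 : ∀ t, z0 (t + 1) = (A + B * L) *ᵥ xh0 t)
    -- bias dynamics
    (ω π ρ : ℕ → Fin n → ℝ)
    (hω0 : ω 0 = 0) (hπ0 : π 0 = 0) (hρ0 : ρ 0 = 0)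
    (hω : ∀ t, ω (t + 1) =
      ((1 - K * C) * A + B * L) *ᵥ ω t + (K * C) *ᵥ π t + (K * C) *ᵥ ρ t +
        (K * Ψ) *ᵥ e t)
    (hπ : ∀ t, π (t + 1) = A *ᵥ π t + (A * B * L) *ᵥ ω t)
    (hρ : ∀ t, ρ (t + 1) = A *ᵥ ρ t + Γ *ᵥ e t) :
    ∀ t : ℕ,
      xhe t - xh0 t = ω (t + 1) ∧
      νe t - ν0 t = -((C * A) *ᵥ ω t) + C *ᵥ π t + C *ᵥ ρ t + Ψ *ᵥ e t := by
  have innovation : ∀ t, xe t = x0 t + ((B * L) *ᵥ ω t + π t + ρ t) →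
      ze t = z0 t + (A + B * L) *ᵥ ω t →
      νe t = ν0 t + (-((C * A) *ᵥ ω t) + C *ᵥ π t + C *ᵥ ρ t + Ψ *ᵥ e t) := by
    intro t hx hz
    rw [hνe, hye, hν0, hy0, hx, hz]
    simp only [mulVec_add, add_mulVec, ← mulVec_mulVec]
    abel
  have estimate : ∀ t, xe t = x0 t + ((B * L) *ᵥ ω t + π t + ρ t) →
      ze t = z0 t + (A + B * L) *ᵥ ω t → xhe t = xh0 t + ω (t + 1) := by
    intro t hx hz
    rw [hxhe, hxh0, innovation t hx hz, hz, hω]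
    simp only [mulVec_add, mulVec_neg, add_mulVec, sub_mulVec, sub_mul, one_mul,
      ← mulVec_mulVec]
    abel
  have state : ∀ t, xe t = x0 t + ((B * L) *ᵥ ω t + π t + ρ t) ∧
      ze t = z0 t + (A + B * L) *ᵥ ω t := by
    intro t
    induction t with
    | zero => simp [hxe0, hze0, hx00, hz00, hω0, hπ0, hρ0]
    | succ t ih =>
      have hx := estimate t ih.1 ih.2
      constructor
      · rw [hxe, hx0, hx, ih.1, hπ, hρ]
        simp only [mulVec_add, ← mulVec_mulVec]
        abel
      · rw [hze, hz0, hx, mulVec_add]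
  intro t
  obtain ⟨hx, hz⟩ := state t
  exact ⟨sub_eq_of_eq_add' (estimate t hx hz), sub_eq_of_eq_add' (innovation t hx hz)⟩
end
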